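/- Let K be a h-convex body in ℍ^{n+1} with d(O,X) ≤ M for all X ∈ K, where M > 0. Then |u(K,e)| ≤ M for every e ∈ 𝕊^n, and the horospherical support function is Lipschitz: |u(K,e_1) − u(K,e_2)| ≤ ((e^{2M} − 1)/2) |e_1 − e_2| for all e_1, e_2 ∈ 𝕊^n, where |e_1 − e_2| is the Euclidean norm in ℝ^{n+1}. -/

import Mathlib

noncomputable section

open Real MeasureTheory Filter Topology Set
open scoped ENNReal symmDiff

namespace Horo

/-- The Lorentzian inner product on ℝ^{n+2}:
`X·Y = Σ_{i=1}^{n+1} x_i y_i − x_{n+2} y_{n+2}`. -/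
def lprod (n : ℕ) (X Y : Fin (n + 2) → ℝ) : ℝ :=
  (∑ i : Fin (n + 1), X i.castSucc * Y i.castSucc) - X (Fin.last (n + 1)) * Y (Fin.last (n + 1))

/-- The hyperboloid model ℍ^{n+1} of hyperbolic space. -/
def Hyp (n : ℕ) : Set (Fin (n + 2) → ℝ) :=
  {X | lprod n X X = -1 ∧ 0 < X (Fin.last (n + 1))}

/-- The origin O = (0,…,0,1) of hyperbolic space. -/
def origin (n : ℕ) : Fin (n + 2) → ℝ := Fin.snoc (fun _ => 0) 1

/-- The unit sphere 𝕊^n ⊂ ℝ^{n+1}. -/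
def sph (n : ℕ) : Set (Fin (n + 1) → ℝ) := {e | ∑ i, e i ^ 2 = 1}

/-- The null vector (e,1) ∈ ℝ^{n+2} associated with e ∈ 𝕊^n. -/
def dir {n : ℕ} (e : Fin (n + 1) → ℝ) : Fin (n + 2) → ℝ := Fin.snoc e 1

/-- The geodesic distance d(X,Y) = arcosh(−X·Y) on the hyperboloid. -/
def dH (n : ℕ) (X Y : Fin (n + 2) → ℝ) : ℝ :=
  Real.log (-(lprod n X Y) + Real.sqrt ((lprod n X Y) ^ 2 - 1))

/-- The horosphere H_e(s) = {X ∈ ℍ^{n+1} : X·(e,1) = −e^s}. -/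
def horoSphere (n : ℕ) (e : Fin (n + 1) → ℝ) (s : ℝ) : Set (Fin (n + 2) → ℝ) :=
  {X ∈ Hyp n | lprod n X (dir e) = -Real.exp s}

/-- The open horo-ball B_e(s) = {X ∈ ℍ^{n+1} : 0 > X·(e,1) > −e^s}. -/
def horoBall (n : ℕ) (e : Fin (n + 1) → ℝ) (s : ℝ) : Set (Fin (n + 2) → ℝ) :=
  {X ∈ Hyp n | 0 > lprod n X (dir e) ∧ lprod n X (dir e) > -Real.exp s}

/-- The closed horo-ball B̄_e(s) = {X ∈ ℍ^{n+1} : 0 > X·(e,1) ≥ −e^s}. -/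
def horoBallCl (n : ℕ) (e : Fin (n + 1) → ℝ) (s : ℝ) : Set (Fin (n + 2) → ℝ) :=
  {X ∈ Hyp n | 0 > lprod n X (dir e) ∧ lprod n X (dir e) ≥ -Real.exp s}

/-- A set Ω ⊂ ℍ^{n+1} is horospherically convex (h-convex) if it is closed and every
relative boundary point of Ω admits a supporting horo-ball. -/
def IsHConvex (n : ℕ) (Ω : Set (Fin (n + 2) → ℝ)) : Prop :=
  Ω ⊆ Hyp n ∧ IsClosed Ω ∧
    ∀ X ∈ Ω ∩ closure (Hyp n \ Ω),
      ∃ e ∈ sph n, ∃ s : ℝ, Ω ⊆ horoBallCl n e s ∧ X ∈ horoSphere n e s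

/-- The interior of a subset of the hyperboloid, relative to the hyperboloid. -/
def relInt (n : ℕ) (K : Set (Fin (n + 2) → ℝ)) : Set (Fin (n + 2) → ℝ) :=
  {X ∈ Hyp n | ∃ ε > 0, ∀ Y ∈ Hyp n, dH n X Y < ε → Y ∈ K}

/-- A h-convex body: a compact h-convex set with nonempty (relative) interior. -/
def IsHConvexBody (n : ℕ) (K : Set (Fin (n + 2) → ℝ)) : Prop :=
  IsHConvex n K ∧ IsCompact K ∧ (relInt n K).Nonempty

/-- A h-convex polytope: a h-convex body which is a finite intersection of closed
horo-balls. -/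
def IsHPolytope (n : ℕ) (P : Set (Fin (n + 2) → ℝ)) : Prop :=
  IsHConvexBody n P ∧ ∃ m : ℕ, 2 ≤ m ∧ ∃ (e : Fin m → (Fin (n + 1) → ℝ)) (u : Fin m → ℝ),
    (∀ i, e i ∈ sph n) ∧ P = ⋂ i, horoBallCl n (e i) (u i)

/-- The horospherical support function u(K,e) = sup{log(−X·(e,1)) : X ∈ K}. -/
def suppFn (n : ℕ) (K : Set (Fin (n + 2) → ℝ)) (e : Fin (n + 1) → ℝ) : ℝ :=
  sSup ((fun X => Real.log (-(lprod n X (dir e)))) '' K)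

/-- The outer parallel set K^ε = {X ∈ ℍ^{n+1} : d(K,X) ≤ ε}. -/
def outPar (n : ℕ) (K : Set (Fin (n + 2) → ℝ)) (ε : ℝ) : Set (Fin (n + 2) → ℝ) :=
  {X ∈ Hyp n | ∃ Y ∈ K, dH n Y X ≤ ε}

/-- The Hausdorff distance d_H(K,L) = inf{ε ≥ 0 : K ⊆ L^ε and L ⊆ K^ε}. -/
def dHaus (n : ℕ) (K L : Set (Fin (n + 2) → ℝ)) : ℝ :=
  sInf {ε : ℝ | 0 ≤ ε ∧ K ⊆ outPar n L ε ∧ L ⊆ outPar n K ε}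

/-- The point (sinh r · θ, cosh r) ∈ ℍ^{n+1} at distance r from O in direction θ. -/
def rpt (n : ℕ) (θ : Fin (n + 1) → ℝ) (r : ℝ) : Fin (n + 2) → ℝ :=
  Fin.snoc (fun i => Real.sinh r * θ i) (Real.cosh r)

/-- The radial function ρ(K,θ) = max{λ ≥ 0 : (sinh λ · θ, cosh λ) ∈ K}. -/
def radFn (n : ℕ) (K : Set (Fin (n + 2) → ℝ)) (θ : Fin (n + 1) → ℝ) : ℝ :=
  sSup {r : ℝ | 0 ≤ r ∧ rpt n θ r ∈ K}

/-- R(K) = max_θ ρ(K,θ). -/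
def Rmax (n : ℕ) (K : Set (Fin (n + 2) → ℝ)) : ℝ := sSup (radFn n K '' sph n)

/-- r(K) = min_θ ρ(K,θ). -/
def rmin (n : ℕ) (K : Set (Fin (n + 2) → ℝ)) : ℝ := sInf (radFn n K '' sph n)

/-- The point reflection (x_1,…,x_{n+1},x_{n+2}) ↦ (−x_1,…,−x_{n+1},x_{n+2}) about O. -/
def symMap (n : ℕ) (X : Fin (n + 2) → ℝ) : Fin (n + 2) → ℝ :=
  fun i => if i = Fin.last (n + 1) then X i else -X i

/-- The hyperbolic (Riemannian) volume of a subset of the hyperboloid, computed via the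
graph parametrization x ↦ (x, √(1+|x|²)), whose volume density is 1/√(1+|x|²). -/
def hypVol (n : ℕ) (K : Set (Fin (n + 2) → ℝ)) : ℝ :=
  ∫ x : Fin (n + 1) → ℝ,
    Set.indicator {y : Fin (n + 1) → ℝ | Fin.snoc y (Real.sqrt (1 + ∑ i, y i ^ 2)) ∈ K}
      (fun y => 1 / Real.sqrt (1 + ∑ i, y i ^ 2)) x

/-- The distance from a point X to a set P. -/
def distTo (n : ℕ) (P : Set (Fin (n + 2) → ℝ)) (X : Fin (n + 2) → ℝ) : ℝ :=
  sInf ((fun Y => dH n Y X) '' P)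

/-- The facet F(P,e) = P ∩ H_e(u(P,e)). -/
def facet (n : ℕ) (P : Set (Fin (n + 2) → ℝ)) (e : Fin (n + 1) → ℝ) :
    Set (Fin (n + 2) → ℝ) :=
  P ∩ horoSphere n e (suppFn n P e)

/-- The relative interior of the facet F(P,e) inside the horosphere H_e(u(P,e)). -/
def facetRelInt (n : ℕ) (P : Set (Fin (n + 2) → ℝ)) (e : Fin (n + 1) → ℝ) :
    Set (Fin (n + 2) → ℝ) :=
  {Y ∈ facet n P e | ∃ δ > 0, ∀ Z ∈ horoSphere n e (suppFn n P e),
    dH n Y Z < δ → Z ∈ facet n P e}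

/-- The collar 𝒫_t(P, F̊(P,e)): points at positive distance ≤ t from P whose nearest
point in P lies in the relative interior of the facet F(P,e). -/
def collar (n : ℕ) (P : Set (Fin (n + 2) → ℝ)) (e : Fin (n + 1) → ℝ) (t : ℝ) :
    Set (Fin (n + 2) → ℝ) :=
  {X ∈ Hyp n | 0 < distTo n P X ∧ distTo n P X ≤ t ∧
    ∃ Y ∈ facetRelInt n P e, ∀ Z ∈ P, dH n Y X ≤ dH n Z X}

/-- The diameter of a set with respect to a distance function, in ℝ≥0∞. -/
def ediamWith {α : Type*} (d : α → α → ℝ) (U : Set α) : ℝ≥0∞ :=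
  ⨆ (x ∈ U) (y ∈ U), ENNReal.ofReal (d x y)

/-- The (unnormalized) s-dimensional Hausdorff measure associated with a distance
function d, via the Carathéodory construction. -/
def hMeasWith {α : Type*} (d : α → α → ℝ) (s : ℕ) (A : Set α) : ℝ≥0∞ :=
  ⨆ (δ : ℝ) (_ : 0 < δ),
    ⨅ (U : ℕ → Set α) (_ : A ⊆ ⋃ i, U i) (_ : ∀ i, ediamWith d (U i) ≤ ENNReal.ofReal δ),
      ∑' i, ediamWith d (U i) ^ s

/-- ω_n, the volume of the unit ball in ℝ^n. -/
def unitBallVol (n : ℕ) : ℝ :=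
  (volume (Metric.ball (0 : EuclideanSpace ℝ (Fin n)) 1)).toReal

/-- S(P,e): the n-dimensional area of the facet F(P,e), i.e. the normalized
n-dimensional Hausdorff measure of F(P,e) with respect to the hyperbolic distance. -/
def areaFacet (n : ℕ) (P : Set (Fin (n + 2) → ℝ)) (e : Fin (n + 1) → ℝ) : ℝ :=
  (ENNReal.ofReal (unitBallVol n / 2 ^ n) * hMeasWith (dH n) n (facet n P e)).toReal


lemma lprod_dir (n : ℕ) (X : Fin (n + 2) → ℝ) (e : Fin (n + 1) → ℝ) :
    lprod n X (dir e) = ∑ i, X i.castSucc * e i - X (Fin.last (n + 1)) := by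
  simp [lprod, dir, Fin.snoc_castSucc (α := fun _ => ℝ), Fin.snoc_last (α := fun _ => ℝ)]

lemma lprod_origin (n : ℕ) (X : Fin (n + 2) → ℝ) :
    lprod n (origin n) X = -X (Fin.last (n + 1)) := by
  simp [lprod, origin, Fin.snoc_castSucc (α := fun _ => ℝ), Fin.snoc_last (α := fun _ => ℝ)]

lemma dH_self {n : ℕ} {X : Fin (n + 2) → ℝ} (hX : X ∈ Hyp n) : dH n X X = 0 := by
  simp [dH, hX.1]

lemma relInt_subset {n : ℕ} {K : Set (Fin (n + 2) → ℝ)} : relInt n K ⊆ K := by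
  rintro X ⟨hX, ε, hε, h⟩
  exact h X hX (by rwa [dH_self hX])

lemma abs_sum_mul_le {ι : Type*} [Fintype ι] (x y : ι → ℝ) :
    |∑ i, x i * y i| ≤ √(∑ i, x i ^ 2) * √(∑ i, y i ^ 2) := by
  rw [abs_le]
  constructor
  · have := Real.sum_mul_le_sqrt_mul_sqrt Finset.univ (fun i => -x i) y
    simp only [neg_mul, Finset.sum_neg_distrib, neg_sq] at this
    linarith
  · exact Real.sum_mul_le_sqrt_mul_sqrt Finset.univ x y

/-- The spatial radius `r` and the height `t` of a point of the hyperboloid within distance `M` of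
the origin satisfy `t + r ≤ e^M` and `e^{-M} ≤ t - r`. -/
lemma height_radius_bounds {n : ℕ} {X : Fin (n + 2) → ℝ} (hX : X ∈ Hyp n) {M : ℝ}
    (hM : dH n (origin n) X ≤ M) :
    X (Fin.last (n + 1)) + √(∑ i : Fin (n + 1), X i.castSucc ^ 2) ≤ exp M ∧
      exp (-M) ≤ X (Fin.last (n + 1)) - √(∑ i : Fin (n + 1), X i.castSucc ^ 2) := by
  obtain ⟨h, ht⟩ := hX
  set t := X (Fin.last (n + 1)) with ht_def
  have hsum : t ^ 2 - 1 = ∑ i : Fin (n + 1), X i.castSucc ^ 2 := by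
    simp only [lprod, ← sq] at h
    linarith
  rw [dH, lprod_origin, ← ht_def, neg_neg, neg_sq, hsum] at hM
  have hr := Real.sqrt_nonneg (∑ i : Fin (n + 1), X i.castSucc ^ 2)
  have hr2 := Real.sq_sqrt (Finset.sum_nonneg fun i _ => sq_nonneg _ :
    0 ≤ ∑ i : Fin (n + 1), X i.castSucc ^ 2)
  set r := √(∑ i : Fin (n + 1), X i.castSucc ^ 2)
  have hpos : 0 < t + r := by linarith
  have hle : t + r ≤ exp M := (Real.log_le_iff_le_exp hpos).1 hM
  refine ⟨hle, ?_⟩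
  have hinv : t - r = (t + r)⁻¹ := eq_inv_of_mul_eq_one_left (by nlinarith)
  rw [hinv, Real.exp_neg]
  exact inv_anti₀ hpos hle

lemma neg_lprod_dir_bounds {n : ℕ} {X : Fin (n + 2) → ℝ} (hX : X ∈ Hyp n) {M : ℝ}
    (hM : dH n (origin n) X ≤ M) {e : Fin (n + 1) → ℝ} (he : e ∈ sph n) :
    exp (-M) ≤ -lprod n X (dir e) ∧ -lprod n X (dir e) ≤ exp M := by
  obtain ⟨h₁, h₂⟩ := height_radius_bounds hX hM
  have h := abs_le.1 (abs_sum_mul_le (fun i : Fin (n + 1) => X i.castSucc) e)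
  rw [show ∑ i, e i ^ 2 = 1 from he, Real.sqrt_one, mul_one] at h
  rw [lprod_dir]
  constructor <;> linarith [h.1, h.2]

lemma abs_log_neg_lprod_dir_le {n : ℕ} {X : Fin (n + 2) → ℝ} (hX : X ∈ Hyp n) {M : ℝ}
    (hM : dH n (origin n) X ≤ M) {e : Fin (n + 1) → ℝ} (he : e ∈ sph n) :
    |Real.log (-lprod n X (dir e))| ≤ M := by
  obtain ⟨h₁, h₂⟩ := neg_lprod_dir_bounds hX hM he
  have hpos := (Real.exp_pos _).trans_le h₁
  exact abs_le.2 ⟨(Real.le_log_iff_exp_le hpos).2 h₁, (Real.log_le_iff_le_exp hpos).2 h₂⟩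

lemma log_neg_lprod_dir_sub_le {n : ℕ} {X : Fin (n + 2) → ℝ} (hX : X ∈ Hyp n) {M : ℝ}
    (hM : dH n (origin n) X ≤ M) {e₁ e₂ : Fin (n + 1) → ℝ} (he₁ : e₁ ∈ sph n)
    (he₂ : e₂ ∈ sph n) :
    Real.log (-lprod n X (dir e₁)) - Real.log (-lprod n X (dir e₂)) ≤
      (exp (2 * M) - 1) / 2 * √(∑ i, (e₁ i - e₂ i) ^ 2) := by
  obtain ⟨h₁, h₂⟩ := height_radius_bounds hX hM
  have hb₁ := (neg_lprod_dir_bounds hX hM he₁).1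
  have hb₂ := (neg_lprod_dir_bounds hX hM he₂).1
  have hcs := (abs_le.1 (abs_sum_mul_le (fun i : Fin (n + 1) => X i.castSucc)
    (fun i => e₁ i - e₂ i))).1
  simp only [mul_sub, Finset.sum_sub_distrib] at hcs
  have hd := lprod_dir n X e₁
  have hd' := lprod_dir n X e₂
  set D := √(∑ i, (e₁ i - e₂ i) ^ 2)
  have hD : 0 ≤ D := Real.sqrt_nonneg _
  set a := -lprod n X (dir e₁)
  set b := -lprod n X (dir e₂)
  set r := √(∑ i : Fin (n + 1), X i.castSucc ^ 2)
  have hE := Real.exp_pos (-M)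
  have ha : 0 < a := hE.trans_le hb₁
  have hb : 0 < b := hE.trans_le hb₂
  have hab : a - b ≤ r * D := by linarith
  have hr : r ≤ (exp M - exp (-M)) / 2 := by linarith
  have hr0 : 0 ≤ r := Real.sqrt_nonneg _
  have hexp : exp (2 * M) = exp M * exp M := by rw [two_mul, Real.exp_add]
  have hone : exp (-M) * exp M = 1 := by rw [← Real.exp_add]; simp
  calc Real.log a - Real.log b = Real.log (a / b) := (Real.log_div ha.ne' hb.ne').symm
    _ ≤ a / b - 1 := Real.log_le_sub_one_of_pos (div_pos ha hb)
    _ = (a - b) / b := by field_simp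
    _ ≤ r * D / b := by gcongr
    _ ≤ r * D / exp (-M) := by gcongr
    _ ≤ (exp M - exp (-M)) / 2 * D / exp (-M) := by gcongr
    _ = (exp (2 * M) - 1) / 2 * D := by
      rw [div_eq_iff hE.ne', hexp]
      linear_combination (-(exp M) * D / 2) * hone

lemma suppFn_sub_le {n : ℕ} {K : Set (Fin (n + 2) → ℝ)} (hK : K ⊆ Hyp n) (hne : K.Nonempty)
    {M : ℝ} (hbd : ∀ X ∈ K, dH n (origin n) X ≤ M) {e₁ e₂ : Fin (n + 1) → ℝ}
    (he₁ : e₁ ∈ sph n) (he₂ : e₂ ∈ sph n) :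
    suppFn n K e₁ - suppFn n K e₂ ≤ (exp (2 * M) - 1) / 2 * √(∑ i, (e₁ i - e₂ i) ^ 2) := by
  rw [sub_le_iff_le_add]
  refine csSup_le (hne.image _) ?_
  rintro _ ⟨X, hX, rfl⟩
  have hle : Real.log (-lprod n X (dir e₂)) ≤ suppFn n K e₂ := by
    refine le_csSup ⟨M, ?_⟩ ⟨X, hX, rfl⟩
    rintro _ ⟨Y, hY, rfl⟩
    exact (abs_le.1 (abs_log_neg_lprod_dir_le (hK hY) (hbd Y hY) he₂)).2
  linarith [log_neg_lprod_dir_sub_le (hK hX) (hbd X hX) he₁ he₂]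

/-- If a h-convex body `K` satisfies `d(O,X) ≤ M` for all `X ∈ K`, then `|u(K,e)| ≤ M`
for all `e ∈ 𝕊^n` and `u(K,·)` is Lipschitz with constant `(e^{2M} − 1)/2` with respect
to the Euclidean norm on ℝ^{n+1}. -/
theorem suppFn_bounded_and_lipschitz (n : ℕ) (hn : 1 ≤ n)
    (K : Set (Fin (n + 2) → ℝ)) (hK : IsHConvexBody n K)
    (M : ℝ) (hM : 0 < M) (hbd : ∀ X ∈ K, dH n (origin n) X ≤ M) :
    (∀ e ∈ sph n, |suppFn n K e| ≤ M) ∧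
    ∀ e₁ ∈ sph n, ∀ e₂ ∈ sph n,
      |suppFn n K e₁ - suppFn n K e₂| ≤
        (Real.exp (2 * M) - 1) / 2 * Real.sqrt (∑ i, (e₁ i - e₂ i) ^ 2) := by
  obtain ⟨⟨hsub, -, -⟩, -, hint⟩ := hK
  have hne : K.Nonempty := hint.mono relInt_subset
  refine ⟨fun e he => ?_, fun e₁ he₁ e₂ he₂ => ?_⟩
  · have hlog : ∀ X ∈ K, |Real.log (-lprod n X (dir e))| ≤ M := fun X hX =>
      abs_log_neg_lprod_dir_le (hsub hX) (hbd X hX) he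
    have hub : ∀ y ∈ (fun X => Real.log (-lprod n X (dir e))) '' K, y ≤ M := by
      rintro _ ⟨X, hX, rfl⟩
      exact (abs_le.1 (hlog X hX)).2
    obtain ⟨X, hX⟩ := hne
    exact abs_le.2 ⟨(abs_le.1 (hlog X hX)).1.trans (le_csSup ⟨M, hub⟩ ⟨X, hX, rfl⟩),
      csSup_le ⟨_, X, hX, rfl⟩ hub⟩
  · refine abs_sub_le_iff.2 ⟨suppFn_sub_le hsub hne hbd he₁ he₂, ?_⟩
    simp only [fun i => sub_sq_comm (e₁ i) (e₂ i)]
    exact suppFn_sub_le hsub hne hbd he₂ he₁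

end Horo
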